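/- arXiv:2509.24432 — 3 statements merged into one kernel-verified Lean document; each statement's English description precedes it below -/
import Mathlib

section
/- The encoding map Enc sending (L₁,R₁,L₂,R₂,z_L,z_R,k₁,k₂,k₃) to (L₁^{(k₁,k₃)} ∪ L₂^{(k₂,z_L)}, R₁^{(k₁,k₃)} ∪ R₂^{(k₂,z_R)}, k₁, k₂, k₃) (unions taken as multiset unions) is injective on the set of tuples in which L₁, L₂ are I-distinct relations, R₁, R₂ are D-distinct relations, and (k₁,k₂,k₃,z_L,z_R) satisfies the decodability conditions with respect to (L₁,L₂,R₁,R₂). -/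
open Multiset

noncomputable section
open scoped Classical

namespace QHROM

instance (l : ℕ) : Fintype (BitVec l) :=
  Fintype.ofEquiv (Fin (2 ^ l)) ⟨BitVec.ofFin, BitVec.toFin, fun _ => rfl, fun _ => rfl⟩

/-- A relation: a finite multiset of pairs of `λ`-bit strings. -/
abbrev Rel (l : ℕ) := Multiset (BitVec l × BitVec l)

/-- `I`-distinct: the second coordinates are pairwise distinct. -/
def IDist {l : ℕ} (L : Rel l) : Prop := (L.map Prod.snd).Nodup

/-- `D`-distinct: the first coordinates are pairwise distinct. -/
def DDist {l : ℕ} (L : Rel l) : Prop := (L.map Prod.fst).Nodup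

/-- The set of first coordinates of a relation. -/
def Dom {l : ℕ} (L : Rel l) : Finset (BitVec l) := (L.map Prod.fst).toFinset

/-- The set of second coordinates of a relation. -/
def Im {l : ℕ} (L : Rel l) : Finset (BitVec l) := (L.map Prod.snd).toFinset

/-- `A ⊕ b` for a set of bit strings. -/
def xorC {l : ℕ} (A : Finset (BitVec l)) (b : BitVec l) : Finset (BitVec l) :=
  A.image (fun a => a ^^^ b)

/-- `A ⊕ B` for sets of bit strings. -/
def xorS {l : ℕ} (A B : Finset (BitVec l)) : Finset (BitVec l) :=
  (A ×ˢ B).image (fun p => p.1 ^^^ p.2)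

/-- 0-indexed position of `y` in the canonical (numeric/lexicographic) ordering of `S`. -/
def pos {l : ℕ} (S : Finset (BitVec l)) (y : BitVec l) : ℕ :=
  (S.filter (fun a => a.toNat < y.toNat)).card

/-- The augmented relation `L₁^{(k₁,k₃)}`. -/
def aug1 {l : ℕ} (L : Rel l) (k1 k3 : BitVec l) : Rel l :=
  L.map (fun p => (p.1 ^^^ k1, p.2 ^^^ k3))

/-- The augmented relation `L₂^{(k₂,z_L)}` (with `L₂` ordered by second coordinate). -/
def aug2L {l : ℕ} (L2 : Rel l) (k2 : BitVec l) (zL : List (BitVec l)) : Rel l :=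
  L2.bind (fun p =>
    {(p.1, zL.getD (pos (Im L2) p.2) 0), (zL.getD (pos (Im L2) p.2) 0 ^^^ k2, p.2)})

/-- The augmented relation `R₂^{(k₂,z_R)}` (with `R₂` ordered by first coordinate). -/
def aug2R {l : ℕ} (R2 : Rel l) (k2 : BitVec l) (zR : List (BitVec l)) : Rel l :=
  R2.bind (fun p =>
    {(p.1, zR.getD (pos (Dom R2) p.1) 0 ^^^ k2), (zR.getD (pos (Dom R2) p.1) 0, p.2)})

/-- The decodability conditions of a tuple `(k₁,k₂,k₃,z_L,z_R)` w.r.t. `(L₁,L₂,R₁,R₂)`: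
distinctness, disjointness, and no extra `k₂`-correlated pairs. -/
def DecCond {l : ℕ} (L1 L2 R1 R2 : Rel l) (k1 k2 k3 : BitVec l)
    (zL zR : List (BitVec l)) : Prop :=
  (IDist (aug1 L1 k1 k3) ∧ IDist (aug2L L2 k2 zL) ∧
    DDist (aug1 R1 k1 k3) ∧ DDist (aug2R R2 k2 zR)) ∧
  (Disjoint (Im (aug1 L1 k1 k3)) (Im (aug2L L2 k2 zL)) ∧
    Disjoint (Dom (aug1 R1 k1 k3)) (Dom (aug2R R2 k2 zR))) ∧
  ((((aug1 L1 k1 k3 + aug2L L2 k2 zL) ×ˢ (aug1 L1 k1 k3 + aug2L L2 k2 zL)).filter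
      (fun q => q.2.1 = q.1.2 ^^^ k2)).card = Multiset.card L2 ∧
    (((aug1 R1 k1 k3 + aug2R R2 k2 zR) ×ˢ (aug1 R1 k1 k3 + aug2R R2 k2 zR)).filter
      (fun q => q.2.2 = q.1.1 ^^^ k2)).card = Multiset.card R2)

/-- Good tuples `(k₁,k₂,k₃,z_L,z_R) ∈ G(L₁,L₂;R₁,R₂)`. -/
def Good {l : ℕ} (L1 L2 R1 R2 : Rel l) (k1 k2 k3 : BitVec l)
    (zL zR : List (BitVec l)) : Prop :=
  k1 ∉ xorS (Dom L1) (Dom L2) ∪ xorS (Dom R1) (Dom R2) ∧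
  k2 ∉ xorS (xorC (Dom L1) k1 ∪ Dom L2) (xorC (Im L1) k3 ∪ Im L2) ∪
        xorS (xorC (Dom R1) k1 ∪ Dom R2) (xorC (Im R1) k3 ∪ Im R2) ∧
  k3 ∉ xorS (Im L1) (Im L2) ∪ xorS (Im R1) (Im R2) ∧
  zL.Nodup ∧ zR.Nodup ∧
  (∀ z ∈ zL, z ∉ xorC (Im L1) k3 ∪ Im L2 ∪ xorC (xorC (Dom L1) k1 ∪ Dom L2) k2) ∧
  (∀ z ∈ zR, z ∉ xorC (Im R1) k3 ∪ Im R2 ∪ xorC (xorC (Dom R1) k1 ∪ Dom R2) k2)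

end QHROM
end

namespace QHROM

theorem pos_lt_aux {l : ℕ} (S : Finset (BitVec l)) {y y' : BitVec l} (hy : y ∈ S)
    (h : y.toNat < y'.toNat) : pos S y < pos S y' := by
  unfold pos
  apply Finset.card_lt_card
  rw [Finset.ssubset_iff_of_subset]
  · exact ⟨y, by simp [hy, h], by simp⟩
  · intro a ha
    simp only [Finset.mem_filter] at ha ⊢
    exact ⟨ha.1, ha.2.trans h⟩

theorem pos_lt_card {l : ℕ} (S : Finset (BitVec l)) {y : BitVec l} (hy : y ∈ S) :
    pos S y < S.card := by
  unfold pos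
  apply Finset.card_lt_card
  rw [Finset.ssubset_iff_of_subset (Finset.filter_subset _ _)]
  exact ⟨y, hy, by simp⟩

theorem pos_surj {l : ℕ} (S : Finset (BitVec l)) {i : ℕ} (hi : i < S.card) :
    ∃ y ∈ S, pos S y = i := by
  have h := Finset.surjOn_of_injOn_of_card_le (s := S) (t := Finset.range S.card) (pos S)
    (by intro y hy; simpa using pos_lt_card S hy)
    (by
      intro y hy y' hy' he
      rcases lt_trichotomy y.toNat y'.toNat with h | h | h
      · exact absurd he (pos_lt_aux S hy h).ne
      · exact BitVec.eq_of_toNat_eq h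
      · exact absurd he (pos_lt_aux S hy' h).ne')
    (by simp)
  obtain ⟨y, hy, e⟩ := h (show i ∈ (↑(Finset.range S.card) : Set ℕ) by simpa using hi)
  exact ⟨y, hy, e⟩

theorem list_eq_aux {l : ℕ} (S : Finset (BitVec l)) (z z' : List (BitVec l))
    (hz : z.length = S.card) (hz' : z'.length = S.card)
    (h : ∀ y ∈ S, z.getD (pos S y) 0 = z'.getD (pos S y) 0) : z = z' := by
  apply List.ext_getElem (hz.trans hz'.symm)
  intro i h1 h2
  obtain ⟨y, hy, e⟩ := pos_surj S (i := i) (by omega)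
  have := h y hy
  rw [e] at this
  simpa [List.getD_eq_getElem, h1, h2] using this

theorem core_aux {α γ : Type*} (L : Multiset α) (C : Multiset γ) (g : α → γ) (d : γ → α)
    (hd : ∀ p, d (g p) = p) (hn : L.Nodup) (hm : ∀ p ∈ L, g p ∈ C)
    (hc : Multiset.card C = Multiset.card L) : L.map g = C := by
  apply Multiset.eq_of_le_of_card_le
  · rw [Multiset.le_iff_subset (hn.map (Function.LeftInverse.injective hd))]
    intro x hx
    obtain ⟨p, hp, rfl⟩ := Multiset.mem_map.1 hx
    exact hm p hp
  · simp [hc]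

theorem core_eq {α γ : Type*} (L L' : Multiset α) (g g' : α → γ) (d : γ → α)
    (hd : ∀ p, d (g p) = p) (hd' : ∀ p, d (g' p) = p) (h : L.map g = L'.map g') :
    L = L' ∧ ∀ p ∈ L, g p = g' p := by
  have hL : L = L' := by
    have := congrArg (Multiset.map d) h
    simpa [Multiset.map_map, hd, hd'] using this
  refine ⟨hL, fun p hp => ?_⟩
  have : g p ∈ L'.map g' := h ▸ Multiset.mem_map_of_mem g hp
  obtain ⟨p', _, e⟩ := Multiset.mem_map.1 this
  have h2 := congrArg d e
  rw [hd, hd'] at h2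
  rw [← e, h2]

theorem aug1_inj {l : ℕ} {L L' : Rel l} {k1 k3 : BitVec l}
    (h : aug1 L k1 k3 = aug1 L' k1 k3) : L = L' := by
  refine Multiset.map_injective ?_ h
  intro p q e
  simp only [Prod.mk.injEq, BitVec.xor_left_inj] at e
  exact Prod.ext e.1 e.2

theorem card_Im {l : ℕ} {L : Rel l} (h : IDist L) : (Im L).card = Multiset.card L := by
  unfold Im
  rw [Multiset.toFinset_card_of_nodup h, Multiset.card_map]

theorem card_Dom {l : ℕ} {L : Rel l} (h : DDist L) : (Dom L).card = Multiset.card L := by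
  unfold Dom
  rw [Multiset.toFinset_card_of_nodup h, Multiset.card_map]

theorem left_map {l : ℕ} (A L2 : Rel l) (k2 : BitVec l) (zL : List (BitVec l))
    (hL2 : IDist L2) (C : Multiset ((BitVec l × BitVec l) × (BitVec l × BitVec l)))
    (hC : ∀ q, q ∈ C ↔ (q.1 ∈ A + aug2L L2 k2 zL ∧ q.2 ∈ A + aug2L L2 k2 zL) ∧
      q.2.1 = q.1.2 ^^^ k2)
    (hc : Multiset.card C = Multiset.card L2) :
    L2.map (fun p => ((p.1, zL.getD (pos (Im L2) p.2) 0),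
      (zL.getD (pos (Im L2) p.2) 0 ^^^ k2, p.2))) = C := by
  refine core_aux L2 C _ (fun q => (q.1.1, q.2.2)) (fun p => rfl) (Multiset.Nodup.of_map _ hL2) ?_ hc
  intro p hp
  rw [hC]
  refine ⟨⟨?_, ?_⟩, rfl⟩
  · exact Multiset.mem_add.2 (Or.inr (Multiset.mem_bind.2 ⟨p, hp, by simp⟩))
  · exact Multiset.mem_add.2 (Or.inr (Multiset.mem_bind.2 ⟨p, hp, by simp⟩))

theorem right_map {l : ℕ} (A R2 : Rel l) (k2 : BitVec l) (zR : List (BitVec l))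
    (hR2 : DDist R2) (C : Multiset ((BitVec l × BitVec l) × (BitVec l × BitVec l)))
    (hC : ∀ q, q ∈ C ↔ (q.1 ∈ A + aug2R R2 k2 zR ∧ q.2 ∈ A + aug2R R2 k2 zR) ∧
      q.2.2 = q.1.1 ^^^ k2)
    (hc : Multiset.card C = Multiset.card R2) :
    R2.map (fun p => ((zR.getD (pos (Dom R2) p.1) 0, p.2),
      (p.1, zR.getD (pos (Dom R2) p.1) 0 ^^^ k2))) = C := by
  refine core_aux R2 C _ (fun q => (q.2.1, q.1.2)) (fun p => rfl) (Multiset.Nodup.of_map _ hR2) ?_ hc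
  intro p hp
  rw [hC]
  refine ⟨⟨?_, ?_⟩, rfl⟩
  · exact Multiset.mem_add.2 (Or.inr (Multiset.mem_bind.2 ⟨p, hp, by simp⟩))
  · exact Multiset.mem_add.2 (Or.inr (Multiset.mem_bind.2 ⟨p, hp, by simp⟩))

/-- the encoding map
`(L₁,R₁,L₂,R₂,z_L,z_R,k₁,k₂,k₃) ↦ (L₁^{(k₁,k₃)} ∪ L₂^{(k₂,z_L)}, R₁^{(k₁,k₃)} ∪ R₂^{(k₂,z_R)}, k₁,k₂,k₃)`
is injective on tuples with `L₁,L₂` I-distinct, `R₁,R₂` D-distinct, vectors of the right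
lengths, satisfying the decodability conditions. -/
theorem enc_injective {l : ℕ}
    (L1 L2 R1 R2 L1' L2' R1' R2' : Rel l)
    (zL zR zL' zR' : List (BitVec l)) (k1 k2 k3 k1' k2' k3' : BitVec l)
    (hL1 : IDist L1) (hL2 : IDist L2) (hR1 : DDist R1) (hR2 : DDist R2)
    (hL1' : IDist L1') (hL2' : IDist L2') (hR1' : DDist R1') (hR2' : DDist R2')
    (hzL : zL.length = Multiset.card L2) (hzR : zR.length = Multiset.card R2)
    (hzL' : zL'.length = Multiset.card L2') (hzR' : zR'.length = Multiset.card R2')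
    (hdec : DecCond L1 L2 R1 R2 k1 k2 k3 zL zR)
    (hdec' : DecCond L1' L2' R1' R2' k1' k2' k3' zL' zR')
    (heq : (aug1 L1 k1 k3 + aug2L L2 k2 zL, aug1 R1 k1 k3 + aug2R R2 k2 zR, k1, k2, k3)
         = (aug1 L1' k1' k3' + aug2L L2' k2' zL',
            aug1 R1' k1' k3' + aug2R R2' k2' zR', k1', k2', k3')) :
    (L1, R1, L2, R2, zL, zR, k1, k2, k3) = (L1', R1', L2', R2', zL', zR', k1', k2', k3') := by
  simp only [Prod.mk.injEq] at heq
  obtain ⟨eL, eR, rfl, rfl, rfl⟩ := heq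
  obtain ⟨-, -, cL, cR⟩ := hdec
  obtain ⟨-, -, cL', cR'⟩ := hdec'
  have mL := left_map _ L2 k2 zL hL2 _ (fun q => by
    rw [Multiset.mem_filter, Multiset.mem_product]) cL
  have mL' := left_map _ L2' k2 zL' hL2' _ (fun q => by
    rw [Multiset.mem_filter, Multiset.mem_product]) cL'
  have mR := right_map _ R2 k2 zR hR2 _ (fun q => by
    rw [Multiset.mem_filter, Multiset.mem_product]) cR
  have mR' := right_map _ R2' k2 zR' hR2' _ (fun q => by
    rw [Multiset.mem_filter, Multiset.mem_product]) cR'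
  rw [eL, ← mL'] at mL
  rw [eR, ← mR'] at mR
  obtain ⟨rfl, gL⟩ := core_eq _ _ _ _ (fun q => (q.1.1, q.2.2)) (fun p => rfl) (fun p => rfl) mL
  obtain ⟨rfl, gR⟩ := core_eq _ _ _ _ (fun q => (q.2.1, q.1.2)) (fun p => rfl) (fun p => rfl) mR
  have ezL : zL = zL' := by
    refine list_eq_aux (Im L2) _ _ (hzL.trans (card_Im hL2).symm)
      (hzL'.trans (card_Im hL2).symm) ?_
    intro y hy
    obtain ⟨p, hp, rfl⟩ := Multiset.mem_map.1 (Multiset.mem_toFinset.1 hy)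
    exact congrArg (fun q => q.1.2) (gL p hp)
  have ezR : zR = zR' := by
    refine list_eq_aux (Dom R2) _ _ (hzR.trans (card_Dom hR2).symm)
      (hzR'.trans (card_Dom hR2).symm) ?_
    intro y hy
    obtain ⟨p, hp, rfl⟩ := Multiset.mem_map.1 (Multiset.mem_toFinset.1 hy)
    exact congrArg (fun q => q.1.1) (gR p hp)
  subst ezL ezR
  rw [aug1_inj (add_right_cancel eL), aug1_inj (add_right_cancel eR)]

end QHROM
end

section
/- Let L₁, L₂ be I-distinct relations, k₁,k₂,k₃ ∈ {0,1}^λ and z_L ∈ ({0,1}^λ)^{|L₂|}, and suppose: L₁^{(k₁,k₃)} and L₂^{(k₂,z_L)} are I-distinct, Im(L₁^{(k₁,k₃)}) ∩ Im(L₂^{(k₂,z_L)}) = ∅, and there are exactly |L₂| ordered pairs ((x,y),(x',y')) of elements of the multiset L := L₁^{(k₁,k₃)} ∪ L₂^{(k₂,z_L)} with x' = y ⊕ k₂. Write L₂ = {(x₁,y₁),…,(x_q,y_q)} ordered by second coordinate. Then all elements of L are pairwise distinct (so L is a set of size |L₁| + 2q), and the set of ordered pairs (u,v) of elements of L satisfying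 (second coordinate of u) ⊕ k₂ = (first coordinate of v) is exactly {((x_i, z_{L,i}), (z_{L,i} ⊕ k₂, y_i)) : 1 ≤ i ≤ q}; in particular no element of L₁^{(k₁,k₃)} occurs in any such pair, no such pair has u = v, and no two distinct such pairs share an element. -/
open Multiset

namespace QHROM

theorem aug2L_eq {l : ℕ} (L2 : Rel l) (k2 : BitVec l) (zL : List (BitVec l)) :
    aug2L L2 k2 zL = L2.map (fun p => (p.1, zL.getD (pos (Im L2) p.2) 0)) +
      L2.map (fun p => (zL.getD (pos (Im L2) p.2) 0 ^^^ k2, p.2)) := by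
  unfold aug2L
  generalize Im L2 = S
  induction L2 using Multiset.induction_on with
  | empty => simp
  | cons a s ih =>
    rw [Multiset.cons_bind, ih]
    simp only [Multiset.map_cons]
    simp only [Multiset.insert_eq_cons, ← Multiset.singleton_add]
    abel

/-- under distinctness, disjointness and the exact-count condition for
`k₂`-correlated pairs, the multiset `L = L₁^{(k₁,k₃)} ∪ L₂^{(k₂,z_L)}` has no repeated
elements, has size `|L₁| + 2|L₂|`, and its `k₂`-correlated ordered pairs are exactly the
pairs `((xᵢ, z_{L,i}), (z_{L,i} ⊕ k₂, yᵢ))`; in particular no element of `L₁^{(k₁,k₃)}`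
occurs in such a pair, no such pair is diagonal, and distinct such pairs are disjoint. -/
theorem correlated_pairs_structure {l : ℕ}
    (L1 L2 : Rel l) (zL : List (BitVec l)) (k1 k2 k3 : BitVec l)
    (hL1 : IDist L1) (hL2 : IDist L2)
    (hzL : zL.length = Multiset.card L2)
    (h1 : IDist (aug1 L1 k1 k3)) (h2 : IDist (aug2L L2 k2 zL))
    (hdisj : Disjoint (Im (aug1 L1 k1 k3)) (Im (aug2L L2 k2 zL)))
    (hcount : (((aug1 L1 k1 k3 + aug2L L2 k2 zL) ×ˢ (aug1 L1 k1 k3 + aug2L L2 k2 zL)).filter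
        (fun q => q.2.1 = q.1.2 ^^^ k2)).card = Multiset.card L2) :
    -- all elements of `L` are pairwise distinct, so `L` is a set of size `|L₁| + 2|L₂|`
    (aug1 L1 k1 k3 + aug2L L2 k2 zL).Nodup ∧
    Multiset.card (aug1 L1 k1 k3 + aug2L L2 k2 zL)
      = Multiset.card L1 + 2 * Multiset.card L2 ∧
    -- the correlated ordered pairs are exactly those coming from `L₂`
    (∀ u ∈ aug1 L1 k1 k3 + aug2L L2 k2 zL, ∀ v ∈ aug1 L1 k1 k3 + aug2L L2 k2 zL,
      (v.1 = u.2 ^^^ k2 ↔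
        ∃ p ∈ L2, u = (p.1, zL.getD (pos (Im L2) p.2) 0) ∧
          v = (zL.getD (pos (Im L2) p.2) 0 ^^^ k2, p.2))) ∧
    -- no element of `L₁^{(k₁,k₃)}` occurs in such a pair, and no such pair is diagonal
    (∀ u ∈ aug1 L1 k1 k3 + aug2L L2 k2 zL, ∀ v ∈ aug1 L1 k1 k3 + aug2L L2 k2 zL,
      v.1 = u.2 ^^^ k2 →
        u ∉ aug1 L1 k1 k3 ∧ v ∉ aug1 L1 k1 k3 ∧ u ≠ v) ∧
    -- no two distinct such pairs share an element
    (∀ u ∈ aug1 L1 k1 k3 + aug2L L2 k2 zL, ∀ v ∈ aug1 L1 k1 k3 + aug2L L2 k2 zL,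
     ∀ u' ∈ aug1 L1 k1 k3 + aug2L L2 k2 zL, ∀ v' ∈ aug1 L1 k1 k3 + aug2L L2 k2 zL,
      v.1 = u.2 ^^^ k2 → v'.1 = u'.2 ^^^ k2 → (u, v) ≠ (u', v') →
        u ≠ u' ∧ u ≠ v' ∧ v ≠ u' ∧ v ≠ v') := by
  have hA := aug2L_eq L2 k2 zL
  have e1 : ((aug1 L1 k1 k3).map Prod.snd).Nodup := h1
  have e2 : ((aug2L L2 k2 zL).map Prod.snd).Nodup := h2
  have e3 : ((aug1 L1 k1 k3 + aug2L L2 k2 zL).map Prod.snd).Nodup := by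
    rw [Multiset.map_add, Multiset.nodup_add]
    refine ⟨e1, e2, ?_⟩
    rw [Multiset.disjoint_left]
    intro a ha hb
    rw [Finset.disjoint_left] at hdisj
    exact hdisj (a := a) (by simpa [Im] using ha) (by simpa [Im] using hb)
  have e4 : Multiset.card (aug1 L1 k1 k3) = Multiset.card L1 := by simp [aug1]
  have hsep : ∀ a ∈ aug1 L1 k1 k3, ∀ b ∈ aug2L L2 k2 zL, a.2 ≠ b.2 := by
    intro a ha b hb hab
    rw [Multiset.map_add, Multiset.nodup_add] at e3
    exact Multiset.disjoint_left.1 e3.2.2 (Multiset.mem_map_of_mem _ ha)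
      (hab ▸ Multiset.mem_map_of_mem _ hb)
  generalize aug1 L1 k1 k3 = A at *
  generalize hz : (fun p : BitVec l × BitVec l => zL.getD (pos (Im L2) p.2) 0) = z at *
  have hz' : ∀ p : BitVec l × BitVec l, zL.getD (pos (Im L2) p.2) 0 = z p := fun p => by rw [← hz]
  simp only [hz'] at *
  generalize aug2L L2 k2 zL = B at *
  rw [hA, Multiset.map_add, Multiset.map_map, Multiset.map_map, Multiset.nodup_add] at e2
  obtain ⟨n1, n2, n3⟩ := e2
  have zinj : ∀ p ∈ L2, ∀ q ∈ L2, z p = z q → p = q := fun p hp q hq h =>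
    Multiset.inj_on_of_nodup_map n1 p hp q hq h
  have zy : ∀ p ∈ L2, ∀ q ∈ L2, z p ≠ q.2 := fun p hp q hq h =>
    Multiset.disjoint_left.1 n3 (Multiset.mem_map.2 ⟨p, hp, rfl⟩)
      (Multiset.mem_map.2 ⟨q, hq, h.symm⟩)
  have yinj : ∀ p ∈ L2, ∀ q ∈ L2, p.2 = q.2 → p = q := fun p hp q hq h =>
    Multiset.inj_on_of_nodup_map n2 p hp q hq h
  have hB1 : ∀ p ∈ L2, (p.1, z p) ∈ B := fun p hp => by
    rw [hA]; exact Multiset.mem_add.2 (Or.inl (Multiset.mem_map.2 ⟨p, hp, rfl⟩))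
  have hB2 : ∀ p ∈ L2, (z p ^^^ k2, p.2) ∈ B := fun p hp => by
    rw [hA]; exact Multiset.mem_add.2 (Or.inr (Multiset.mem_map.2 ⟨p, hp, rfl⟩))
  have hM : L2.map (fun p => (((p.1, z p), (z p ^^^ k2, p.2)) :
      (BitVec l × BitVec l) × (BitVec l × BitVec l))) =
      ((A + B) ×ˢ (A + B)).filter (fun q => q.2.1 = q.1.2 ^^^ k2) := by
    apply Multiset.eq_of_le_of_card_le
    · rw [Multiset.le_iff_subset]
      · intro q hq
        obtain ⟨p, hp, rfl⟩ := Multiset.mem_map.1 hq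
        rw [Multiset.mem_filter, Multiset.mem_product]
        exact ⟨⟨Multiset.mem_add.2 (Or.inr (hB1 p hp)), Multiset.mem_add.2 (Or.inr (hB2 p hp))⟩,
          rfl⟩
      · apply Multiset.Nodup.of_map (fun q => q.2.2)
        rw [Multiset.map_map]
        exact n2
    · rw [hcount, Multiset.card_map]
  have key : ∀ u ∈ A + B, ∀ v ∈ A + B, (v.1 = u.2 ^^^ k2 ↔
        ∃ p ∈ L2, u = (p.1, z p) ∧ v = (z p ^^^ k2, p.2)) := by
    intro u hu v hv
    constructor
    · intro h
      have hm : (u, v) ∈ ((A + B) ×ˢ (A + B)).filter (fun q => q.2.1 = q.1.2 ^^^ k2) :=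
        Multiset.mem_filter.2 ⟨Multiset.mem_product.2 ⟨hu, hv⟩, h⟩
      rw [← hM] at hm
      obtain ⟨p, hp, h⟩ := Multiset.mem_map.1 hm
      exact ⟨p, hp, (Prod.ext_iff.1 h).1.symm, (Prod.ext_iff.1 h).2.symm⟩
    · rintro ⟨p, hp, rfl, rfl⟩
      rfl
  refine ⟨Multiset.Nodup.of_map _ e3, ?_, key, ?_, ?_⟩
  · rw [Multiset.card_add, e4, hA, Multiset.card_add, Multiset.card_map, Multiset.card_map]
    omega
  · intro u hu v hv h
    obtain ⟨p, hp, rfl, rfl⟩ := (key u hu v hv).1 h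
    exact ⟨fun h => hsep _ h _ (hB1 p hp) rfl, fun h => hsep _ h _ (hB2 p hp) rfl,
      fun h => zy p hp p hp (Prod.ext_iff.1 h).2⟩
  · intro u hu v hv u' hu' v' hv' h h' hne
    obtain ⟨p, hp, rfl, rfl⟩ := (key u hu v hv).1 h
    obtain ⟨q, hq, rfl, rfl⟩ := (key u' hu' v' hv').1 h'
    have hpq : p ≠ q := fun e => hne (by rw [e])
    exact ⟨fun e => hpq (zinj p hp q hq (Prod.ext_iff.1 e).2),
      fun e => zy p hp q hq (Prod.ext_iff.1 e).2,
      fun e => zy q hq p hp (Prod.ext_iff.1 e).2.symm,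
      fun e => hpq (yinj p hp q hq (Prod.ext_iff.1 e).2)⟩

end QHROM
end

section
/- Let L₁, L₂ be I-distinct relations, R₁, R₂ D-distinct relations, and (k₁,k₂,k₃,z_L,z_R) ∈ G(L₁,L₂;R₁,R₂). Write L₂ = {(x₁,y₁),…,(x_q,y_q)} ordered by second coordinate. Then for every i ∈ [q]: (1) (source deletion) the element (x_i, z_{L,i}) occurs in the multiset L₁^{(k₁,k₃)} ∪ L₂^{(k₂,z_L)}, the equality of multisets (L₁^{(k₁,k₃)} ∪ L₂^{(k₂,z_L)}) ∖ {(x_i, z_{L,i})} = (L₁ ∪ {(z_{L,i}⊕k₂⊕k₁, y_i⊕k₃)})^{(k₁,k₃)} ∪ (L₂ ∖ {(x_i,y_i)})^{(k₂, z_{L,−i})} holds, and the relation L₁ ∪ {(z_{L,i}⊕k₂⊕k₁, y_i⊕k₃)} is I-distinct; (2) (target deletion) the element (z_{L,i}⊕k₂, y_i) occurs in L₁^{(k₁,k₃)} ∪ L₂^{(k₂,z_L)}, the equality of multisets (L₁^{(k₁,k₃)} ∪ L₂^{(k₂,z_L)}) ∖ {(z_{L,i}⊕k₂, y_i)} = (L₁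 ∪ {(x_i⊕k₁, z_{L,i}⊕k₃)})^{(k₁,k₃)} ∪ (L₂ ∖ {(x_i,y_i)})^{(k₂, z_{L,−i})} holds, and the relation L₁ ∪ {(x_i⊕k₁, z_{L,i}⊕k₃)} is I-distinct. -/
open Multiset

namespace QHROM
open scoped Classical

theorem mem_Im_of_mem {l : ℕ} {L : Rel l} {q : BitVec l × BitVec l} (h : q ∈ L) : q.2 ∈ Im L := by
  unfold Im
  rw [Multiset.mem_toFinset]
  exact Multiset.mem_map_of_mem _ h

theorem Im_cons {l : ℕ} (M : Rel l) (p : BitVec l × BitVec l) :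
    Im (p ::ₘ M) = insert p.2 (Im M) := by
  unfold Im
  rw [Multiset.map_cons, Multiset.toFinset_cons]

theorem pos_insert_of_le {l : ℕ} (S : Finset (BitVec l)) (a y : BitVec l)
    (h : y.toNat ≤ a.toNat) : pos (insert a S) y = pos S y := by
  unfold pos
  rw [Finset.filter_insert, if_neg (by omega)]

theorem pos_insert_of_lt {l : ℕ} (S : Finset (BitVec l)) (a y : BitVec l) (ha : a ∉ S)
    (h : a.toNat < y.toNat) : pos (insert a S) y = pos S y + 1 := by
  unfold pos
  rw [Finset.filter_insert, if_pos h, Finset.card_insert_of_notMem]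
  simp [ha]

theorem pos_mono {l : ℕ} (S : Finset (BitVec l)) (a y : BitVec l)
    (h : a.toNat ≤ y.toNat) : pos S a ≤ pos S y := by
  unfold pos
  apply Finset.card_le_card
  intro x hx
  simp only [Finset.mem_filter] at hx ⊢
  exact ⟨hx.1, by omega⟩

theorem pos_lt {l : ℕ} (S : Finset (BitVec l)) (a y : BitVec l) (ha : a ∈ S)
    (h : a.toNat < y.toNat) : pos S a < pos S y := by
  unfold pos
  apply Finset.card_lt_card
  rw [Finset.ssubset_iff_of_subset]
  · exact ⟨a, by simp [ha, h], by simp⟩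
  · intro x hx
    simp only [Finset.mem_filter] at hx ⊢
    exact ⟨hx.1, by omega⟩

theorem getD_eraseIdx_pos {l : ℕ} (S : Finset (BitVec l)) (p q : BitVec l) (hp : p ∉ S)
    (hq : q ∈ S) (z : List (BitVec l)) :
    (z.eraseIdx (pos (insert p S) p)).getD (pos S q) 0 = z.getD (pos (insert p S) q) 0 := by
  have hne : q.toNat ≠ p.toNat := by
    intro h
    exact hp (BitVec.eq_of_toNat_eq h ▸ hq)
  rw [pos_insert_of_le S p p le_rfl]
  simp only [List.getD_eq_getElem?_getD, List.getElem?_eraseIdx]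
  rcases lt_or_gt_of_ne hne with h | h
  · rw [pos_insert_of_le S p q h.le, if_pos (pos_lt S q p hq h)]
  · rw [pos_insert_of_lt S p q hp h, if_neg (not_lt.mpr (pos_mono S p q h.le))]

theorem aug2L_cons {l : ℕ} (M : Rel l) (p : BitVec l × BitVec l) (hp : p.2 ∉ Im M)
    (k2 : BitVec l) (z : List (BitVec l)) :
    aug2L (p ::ₘ M) k2 z =
      {(p.1, z.getD (pos (Im (p ::ₘ M)) p.2) 0), (z.getD (pos (Im (p ::ₘ M)) p.2) 0 ^^^ k2, p.2)}
        + aug2L M k2 (z.eraseIdx (pos (Im (p ::ₘ M)) p.2)) := by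
  unfold aug2L
  rw [Multiset.cons_bind]
  congr 1
  apply Multiset.bind_congr
  intro q hq
  rw [Im_cons, getD_eraseIdx_pos (Im M) p.2 q.2 hp (mem_Im_of_mem hq)]

theorem aug1_add_singleton {l : ℕ} (L : Rel l) (k1 k3 a b : BitVec l) :
    aug1 (L + {(a ^^^ k1, b ^^^ k3)}) k1 k3 = aug1 L k1 k3 + {(a, b)} := by
  unfold aug1
  simp [BitVec.xor_assoc]

theorem IDist_add_singleton {l : ℕ} (L : Rel l) (a b : BitVec l) (h : IDist L) (hb : b ∉ Im L) :
    IDist (L + {(a, b)}) := by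
  unfold IDist Im at *
  rw [Multiset.mem_toFinset] at hb
  rw [add_comm, Multiset.singleton_add, Multiset.map_cons, Multiset.nodup_cons]
  exact ⟨hb, h⟩

/-- deletion from the augmented database: for a good tuple and for each
element `(xᵢ,yᵢ)` of `L₂` (with `zᵢ = z_{L,i}` the corresponding coordinate of `z_L`,
`i` being the canonical position of `yᵢ` in `Im L₂`):
(1) deleting the source `(xᵢ, zᵢ)` from `L₁^{(k₁,k₃)} ∪ L₂^{(k₂,z_L)}` yields
`(L₁ ∪ {(zᵢ⊕k₂⊕k₁, yᵢ⊕k₃)})^{(k₁,k₃)} ∪ (L₂ ∖ {(xᵢ,yᵢ)})^{(k₂,z_{L,−i})}`, and the enlarged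
`L₁` is I-distinct; (2) analogously for deleting the target `(zᵢ⊕k₂, yᵢ)`. -/
theorem robust_deletion {l : ℕ}
    (L1 L2 R1 R2 : Rel l) (zL zR : List (BitVec l)) (k1 k2 k3 : BitVec l)
    (hL1 : IDist L1) (hL2 : IDist L2) (hR1 : DDist R1) (hR2 : DDist R2)
    (hzL : zL.length = Multiset.card L2) (hzR : zR.length = Multiset.card R2)
    (hgood : Good L1 L2 R1 R2 k1 k2 k3 zL zR) :
    ∀ p ∈ L2,
      -- (1) source deletion
      ((p.1, zL.getD (pos (Im L2) p.2) 0) ∈ aug1 L1 k1 k3 + aug2L L2 k2 zL ∧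
        (aug1 L1 k1 k3 + aug2L L2 k2 zL).erase (p.1, zL.getD (pos (Im L2) p.2) 0)
          = aug1 (L1 + {(zL.getD (pos (Im L2) p.2) 0 ^^^ k2 ^^^ k1, p.2 ^^^ k3)}) k1 k3
              + aug2L (L2.erase p) k2 (zL.eraseIdx (pos (Im L2) p.2)) ∧
        IDist (L1 + {(zL.getD (pos (Im L2) p.2) 0 ^^^ k2 ^^^ k1, p.2 ^^^ k3)})) ∧
      -- (2) target deletion
      ((zL.getD (pos (Im L2) p.2) 0 ^^^ k2, p.2) ∈ aug1 L1 k1 k3 + aug2L L2 k2 zL ∧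
        (aug1 L1 k1 k3 + aug2L L2 k2 zL).erase (zL.getD (pos (Im L2) p.2) 0 ^^^ k2, p.2)
          = aug1 (L1 + {(p.1 ^^^ k1, zL.getD (pos (Im L2) p.2) 0 ^^^ k3)}) k1 k3
              + aug2L (L2.erase p) k2 (zL.eraseIdx (pos (Im L2) p.2)) ∧
        IDist (L1 + {(p.1 ^^^ k1, zL.getD (pos (Im L2) p.2) 0 ^^^ k3)})) := by
  intro p hp
  obtain ⟨M, rfl⟩ := Multiset.exists_cons_of_mem hp
  have hpM : p.2 ∉ Im M := by
    unfold IDist at hL2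
    rw [Multiset.map_cons, Multiset.nodup_cons] at hL2
    unfold Im
    rw [Multiset.mem_toFinset]
    exact hL2.1
  obtain ⟨-, -, h3, -, -, h6, -⟩ := hgood
  have hlt : pos (Im (p ::ₘ M)) p.2 < zL.length := by
    rw [hzL, Im_cons, pos_insert_of_le _ _ _ le_rfl, Multiset.card_cons, Nat.lt_succ_iff]
    unfold pos Im
    refine (Finset.card_filter_le _ _).trans ((Multiset.toFinset_card_le _).trans ?_)
    rw [Multiset.card_map]
  have hz : zL.getD (pos (Im (p ::ₘ M)) p.2) 0 ∈ zL := by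
    rw [List.getD_eq_getElem _ _ hlt]
    exact List.getElem_mem hlt
  rw [aug2L_cons M p hpM, Multiset.erase_cons_head]
  generalize zL.eraseIdx (pos (Im (p ::ₘ M)) p.2) = z'
  generalize zL.getD (pos (Im (p ::ₘ M)) p.2) 0 = z at hz ⊢
  have hy : p.2 ^^^ k3 ∉ Im L1 := by
    intro h
    apply h3
    refine Finset.mem_union_left _ (Finset.mem_image.mpr ⟨(p.2 ^^^ k3, p.2),
      Finset.mem_product.mpr ⟨h, mem_Im_of_mem (q := p) hp⟩, ?_⟩)
    simp [BitVec.xor_comm p.2 k3, BitVec.xor_assoc]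
  have hzI : z ^^^ k3 ∉ Im L1 := by
    intro h
    apply h6 z hz
    refine Finset.mem_union_left _ (Finset.mem_union_left _
      (Finset.mem_image.mpr ⟨z ^^^ k3, h, ?_⟩))
    simp [BitVec.xor_assoc]
  have e1 : aug1 L1 k1 k3 + ({(p.1, z), (z ^^^ k2, p.2)} + aug2L M k2 z') =
      (p.1, z) ::ₘ (aug1 L1 k1 k3 + {(z ^^^ k2, p.2)} + aug2L M k2 z') := by
    simp only [Multiset.insert_eq_cons, ← Multiset.singleton_add]
    abel
  have e2 : aug1 L1 k1 k3 + ({(p.1, z), (z ^^^ k2, p.2)} + aug2L M k2 z') =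
      (z ^^^ k2, p.2) ::ₘ (aug1 L1 k1 k3 + {(p.1, z)} + aug2L M k2 z') := by
    simp only [Multiset.insert_eq_cons, ← Multiset.singleton_add]
    abel
  refine ⟨⟨?_, ?_, IDist_add_singleton _ _ _ hL1 hy⟩, ⟨?_, ?_, IDist_add_singleton _ _ _ hL1 hzI⟩⟩
  · rw [e1]
    exact Multiset.mem_cons_self _ _
  · rw [e1, Multiset.erase_cons_head, aug1_add_singleton]
  · rw [e2]
    exact Multiset.mem_cons_self _ _
  · rw [e2, Multiset.erase_cons_head, aug1_add_singleton]

end QHROM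
end
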